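/- Let (W, S) be a Coxeter system, (Q, φ) a maximal partial special matching with a = φ(e), and q ∈ Q such that a does not lie in the support of q (i.e. a ≰ q in Bruhat order). Then q ⋖ φ(q), and for any reduced word μ representing φ(q), deleting the (unique) occurrence of the letter a from μ yields a reduced word for q. -/

import Mathlib

open CoxeterSystem Polynomial

section CoxPre

variable {B : Type*} {W : Type*} [Group W] {M : CoxeterMatrix B}

/-- The alternating word of length `n` starting with the letter `i`
(and then alternating between `i` and `j`). -/
def altW (i j : B) : ℕ → List B
  | 0 => []
  | n + 1 => i :: altW j i n

variable (cs : CoxeterSystem M W)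

/-- The Bruhat order on a Coxeter group: the reflexive-transitive closure of the
relation `u → u * t` (`t` a reflection) when the length goes up. -/
def bruhatLE : W → W → Prop :=
  Relation.ReflTransGen
    (fun u v => ∃ t, cs.IsReflection t ∧ v = u * t ∧ cs.length u < cs.length v)

/-- The covering relation of the Bruhat order. -/
def bCov (u v : W) : Prop :=
  bruhatLE cs u v ∧ u ≠ v ∧ ∀ z, bruhatLE cs u z → bruhatLE cs z v → z = u ∨ z = v

/-- The set of coatoms of `v` in the Bruhat order. -/
def bCoat (v : W) : Set W := {x | bCov cs x v}

/-- A partial special matching of `W` equipped with the Bruhat order: a Bruhat order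
ideal `dom` together with an involution of it such that `u ⋖ φ u` or `φ u ⋖ u` for all
`u ∈ dom`, satisfying the coatom condition. -/
structure BSM where
  dom : Set W
  toFun : W → W
  ideal : ∀ ⦃x y : W⦄, y ∈ dom → bruhatLE cs x y → x ∈ dom
  maps : ∀ x ∈ dom, toFun x ∈ dom
  invol : ∀ x ∈ dom, toFun (toFun x) = x
  cov : ∀ x ∈ dom, bCov cs (toFun x) x ∨ bCov cs x (toFun x)
  coatom : ∀ u ∈ dom, bCov cs u (toFun u) →
    bCoat cs (toFun u) =
      {u} ∪ {w | ∃ v, bCov cs v u ∧ bCov cs v (toFun v) ∧ w = toFun v}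

/-- The standard dihedral subgroup `⟨s,t⟩` of `W`, as a set. -/
def dihedral (s t : B) : Set W :=
  (Subgroup.closure {cs.simple s, cs.simple t} : Subgroup W)

/-- `w` is full with respect to `J ⊆ S`: for all distinct `i, j ∈ J`, `m i j < ∞` and the
longest element of `⟨i,j⟩` is `≤ w` in Bruhat order. -/
def IsFullWrt (J : Set B) (w : W) : Prop :=
  ∀ i ∈ J, ∀ j ∈ J, i ≠ j →
    M i j ≠ 0 ∧ bruhatLE cs (cs.wordProd (altW i j (M i j))) w

/-- The standard axioms characterizing the `R`-polynomials of the Hecke algebra of `W`. -/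
def RAxioms (R : W → W → Polynomial ℤ) : Prop :=
  (∀ u, R u u = 1) ∧
  (∀ u v, ¬ bruhatLE cs u v → R u v = 0) ∧
  (∀ (i : B) (x y : W),
      cs.length (cs.simple i * x) = cs.length x + 1 →
      cs.length (cs.simple i * y) = cs.length y + 1 →
      R (cs.simple i * x) (cs.simple i * y) = R x y ∧
      R x (cs.simple i * y) = (X - 1) * R x y + X * R (cs.simple i * x) y) ∧
  (∀ (i : B) (x y : W),
      cs.length (x * cs.simple i) = cs.length x + 1 →
      cs.length (y * cs.simple i) = cs.length y + 1 →
      R (x * cs.simple i) (y * cs.simple i) = R x y ∧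
      R x (y * cs.simple i) = (X - 1) * R x y + X * R (x * cs.simple i) y)

variable {cs}

/-- `ψ` extends the partial special matching `φ`. -/
def BExtends (ψ φ : BSM cs) : Prop :=
  φ.dom ⊆ ψ.dom ∧ ∀ x ∈ φ.dom, ψ.toFun x = φ.toFun x

/-- `φ` is a maximal partial special matching. -/
def BMax (φ : BSM cs) : Prop := ∀ ψ : BSM cs, BExtends ψ φ → ψ.dom = φ.dom

/-- `φ` is `g`-regular on the left: its domain is stable under left multiplication by `g`
and `φ` commutes with left multiplication by `g`. -/
def LeftReg (φ : BSM cs) (g : W) : Prop :=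
  (∀ x ∈ φ.dom, g * x ∈ φ.dom) ∧ ∀ x ∈ φ.dom, φ.toFun (g * x) = g * φ.toFun x

/-- `φ` is `g`-regular on the right. -/
def RightReg (φ : BSM cs) (g : W) : Prop :=
  (∀ x ∈ φ.dom, x * g ∈ φ.dom) ∧ ∀ x ∈ φ.dom, φ.toFun (x * g) = φ.toFun x * g

end CoxPre

namespace CoxeterSystem

variable {B : Type*} {W : Type*} [Group W] {M : CoxeterMatrix B} (cs : CoxeterSystem M W)

section Reflection

theorem end_mul_apply {α : Type*} (f g : Function.End α) (x : α) : (f * g) x = f (g x) := rfl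

open scoped Classical in
/-- The action of the `i`-th generator on pairs `(t, e)`: conjugate `t` by the generator and flip
the sign `e` if `t` is the generator. -/
noncomputable def signAct (i : B) : Function.End (W × ZMod 2) :=
  fun p => (cs.simple i * p.1 * cs.simple i, p.2 + if p.1 = cs.simple i then 1 else 0)

open scoped Classical in
theorem signAct_pow (i j : B) (n : ℕ) (t : W) (e : ZMod 2) :
    ((cs.signAct i * cs.signAct j) ^ n) (t, e) =
      ((cs.simple i * cs.simple j) ^ n * t * ((cs.simple i * cs.simple j) ^ n)⁻¹,
        e + ∑ k ∈ Finset.range (2 * n),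
          if t = cs.simple j * (cs.simple i * cs.simple j) ^ k then 1 else 0) := by
  induction n with
  | zero => simp [Function.End.one_def]
  | succ n ih =>
    rw [pow_succ', end_mul_apply, ih]
    set c := cs.simple i * cs.simple j with hc
    have hcinv : c⁻¹ = cs.simple j * cs.simple i := by simp [hc]
    have hj : cs.simple j * c * cs.simple j = c⁻¹ := by simp [hc, mul_assoc]
    have hjn (n : ℕ) : cs.simple j * c ^ n * cs.simple j = (c ^ n)⁻¹ := by
      rw [← inv_pow, ← hj]
      conv_lhs => rw [← cs.inv_simple j]
      conv_rhs => rw [← cs.inv_simple j]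
      have := conj_pow (i := n) (a := (cs.simple j)⁻¹) (b := c)
      simpa using this.symm
    have e1 : c ^ n * t * (c ^ n)⁻¹ = cs.simple j ↔ t = cs.simple j * c ^ (2 * n) := by
      have : cs.simple j * c ^ (2 * n) = (c ^ n)⁻¹ * cs.simple j * c ^ n := by
        rw [← hjn]; simp [two_mul, pow_add, mul_assoc]
      rw [this]
      constructor
      · intro h; rw [← h]; group
      · rintro rfl; group
    have e2 : cs.simple j * (c ^ n * t * (c ^ n)⁻¹) * cs.simple j = cs.simple i ↔
        t = cs.simple j * c ^ (2 * n + 1) := by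
      have : cs.simple j * c ^ (2 * n + 1) =
          (c ^ n)⁻¹ * (cs.simple j * cs.simple i * cs.simple j) * c ^ n := by
        have h3 : cs.simple j * cs.simple i * cs.simple j = cs.simple j * c := by
          simp [hc, mul_assoc]
        rw [h3, ← hjn, two_mul, pow_succ, pow_add]
        simp only [mul_assoc, simple_mul_simple_cancel_left]
        rw [← pow_succ', pow_succ]
      rw [this]
      constructor
      · intro h; rw [← h]; simp [mul_assoc]
      · rintro rfl; simp [mul_assoc]
    rw [show 2 * (n + 1) = 2 * n + 1 + 1 by ring, Finset.sum_range_succ, Finset.sum_range_succ]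
    simp only [end_mul_apply, signAct, e1, e2]
    ext
    · have : (c ^ (n + 1))⁻¹ = (c ^ n)⁻¹ * c⁻¹ := by rw [pow_succ', mul_inv_rev]
      simp only [pow_succ' c n, mul_inv_rev, hcinv]
      simp only [hc, mul_assoc]
    · simp only [add_assoc]

theorem isLiftable_signAct : M.IsLiftable cs.signAct := by
  classical
  intro i j
  funext ⟨t, e⟩
  rw [signAct_pow, simple_mul_simple_pow, two_mul, Finset.sum_range_add]
  simp only [pow_add, simple_mul_simple_pow, one_mul, inv_one, mul_one, CharTwo.add_self_eq_zero,
    add_zero, Function.End.one_def, id]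

/-- The extension of `signAct` to the Coxeter group. -/
noncomputable def signHom : W →* Function.End (W × ZMod 2) :=
  cs.lift ⟨cs.signAct, cs.isLiftable_signAct⟩

open scoped Classical in
theorem signHom_simple (i : B) (t : W) (e : ZMod 2) :
    cs.signHom (cs.simple i) (t, e) =
      (cs.simple i * t * cs.simple i, e + if t = cs.simple i then 1 else 0) := by
  rw [signHom, lift_apply_simple]; rfl

open scoped Classical in
theorem signHom_wordProd (ω : List B) (t : W) (e : ZMod 2) :
    cs.signHom (cs.wordProd ω) (t, e) =
      (cs.wordProd ω * t * (cs.wordProd ω)⁻¹, e + (cs.rightInvSeq ω).count t) := by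
  induction ω with
  | nil => simp [Function.End.one_def]
  | cons i ω ih =>
    rw [wordProd_cons, map_mul, end_mul_apply, ih, signHom_simple,
      rightInvSeq, List.count_cons]
    have : cs.wordProd ω * t * (cs.wordProd ω)⁻¹ = cs.simple i ↔
        (cs.wordProd ω)⁻¹ * cs.simple i * cs.wordProd ω = t := by
      constructor
      · intro h; rw [← h]; group
      · rintro rfl; group
    ext
    · simp [mul_assoc]
    · simp only [this, beq_iff_eq]
      push_cast
      simp only [add_assoc]

theorem signHom_apply (w t : W) (e : ZMod 2) :
    cs.signHom w (t, e) = (w * t * w⁻¹, e + (cs.signHom w (t, 0)).2) := by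
  classical
  obtain ⟨ω, rfl⟩ := cs.wordProd_surjective w
  simp [signHom_wordProd]

theorem IsReflection.signHom_self {t : W} (ht : cs.IsReflection t) (e : ZMod 2) :
    cs.signHom t (t, e) = (t, e + 1) := by
  obtain ⟨w, i, rfl⟩ := ht
  have h : cs.signHom w⁻¹ (w * cs.simple i * w⁻¹, e) =
      (cs.simple i, e + (cs.signHom w⁻¹ (w * cs.simple i * w⁻¹, 0)).2) := by
    rw [signHom_apply]; simp [mul_assoc]
  have h' : cs.signHom w (cs.signHom w⁻¹ (w * cs.simple i * w⁻¹, e)) =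
      (w * cs.simple i * w⁻¹, e) := by
    have : cs.signHom (w * w⁻¹) (w * cs.simple i * w⁻¹, e) = (w * cs.simple i * w⁻¹, e) := by
      simp [Function.End.one_def]
    rwa [map_mul, end_mul_apply] at this
  rw [h] at h'
  rw [map_mul, map_mul, end_mul_apply, end_mul_apply, h, signHom_simple]
  rw [signHom_apply] at h' ⊢
  simp only [Prod.mk.injEq, if_true, simple_mul_simple_self, one_mul] at h' ⊢
  exact ⟨trivial, by rw [add_right_comm, h'.2]⟩

theorem mem_rightInvSeq_of_signHom {ω : List B} {t : W}
    (h : (cs.signHom (cs.wordProd ω) (t, 0)).2 ≠ 0) : t ∈ cs.rightInvSeq ω := by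
  classical
  rw [signHom_wordProd] at h
  by_contra hmem
  simp [List.count_eq_zero_of_not_mem hmem] at h

theorem mem_rightInvSeq_of_isRightInversion {ω : List B} {t : W}
    (h : cs.IsRightInversion (cs.wordProd ω) t) : t ∈ cs.rightInvSeq ω := by
  apply cs.mem_rightInvSeq_of_signHom
  intro h0
  obtain ⟨ω', hω', he⟩ := cs.exists_isReduced (cs.wordProd ω * t)
  have hmem : t ∈ cs.rightInvSeq ω' := by
    apply cs.mem_rightInvSeq_of_signHom
    rw [← he, map_mul, end_mul_apply, h.1.signHom_self,
      signHom_apply, h0]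
    simp
  have := (cs.isRightInversion_of_mem_rightInvSeq hω' hmem).2
  rw [← he, mul_assoc, h.1.mul_self, mul_one] at this
  exact absurd h.2 (by omega)

/-- The strong exchange property. -/
theorem exists_wordProd_eraseIdx_of_isRightInversion {ω : List B} {t : W}
    (h : cs.IsRightInversion (cs.wordProd ω) t) :
    ∃ j < ω.length, cs.wordProd ω * t = cs.wordProd (ω.eraseIdx j) := by
  obtain ⟨j, hj, rfl⟩ := List.mem_iff_getElem.mp (cs.mem_rightInvSeq_of_isRightInversion h)
  refine ⟨j, by simpa using hj, ?_⟩
  rw [← wordProd_mul_getD_rightInvSeq, List.getD_eq_getElem _ _ hj]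

/-- The deletion property: every word has a reduced subword with the same product. -/
theorem exists_isReduced_sublist (ω : List B) :
    ∃ ω', ω'.Sublist ω ∧ cs.IsReduced ω' ∧ cs.wordProd ω' = cs.wordProd ω := by
  induction ω using List.reverseRecOn with
  | nil => exact ⟨[], .refl _, by simp [IsReduced], rfl⟩
  | append_singleton ω i ih =>
    obtain ⟨ω', hs, hr, hp⟩ := ih
    by_cases h : cs.IsRightDescent (cs.wordProd ω') i
    · obtain ⟨j, hj, he⟩ := cs.exists_wordProd_eraseIdx_of_isRightInversion
        ((cs.isRightInversion_simple_iff_isRightDescent _ _).2 h)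
      refine ⟨ω'.eraseIdx j, ((List.eraseIdx_sublist _ _).trans hs).trans
        (List.sublist_append_left _ _), ?_, ?_⟩
      · rw [cs.isRightDescent_iff, he, hr.eq, ← List.length_eraseIdx_add_one hj] at h
        simpa [IsReduced] using h
      · rw [← he, hp]; simp [wordProd_append]
    · refine ⟨ω' ++ [i], hs.append (.refl _), ?_, by simp [wordProd_append, hp]⟩
      rw [cs.not_isRightDescent_iff, hr.eq] at h
      simpa [IsReduced, wordProd_append] using h

end Reflection

section Geometric

open Real Module

/-- The geometric coroots: the pairing of the simple roots is given by `-2 cos (π / M i j)`. -/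
noncomputable def coroot (M : CoxeterMatrix B) (i : B) : Dual ℝ (B →₀ ℝ) :=
  Finsupp.lift ℝ ℝ B fun j => -2 * cos (π / M i j)

theorem coroot_single (i j : B) :
    coroot M i (Finsupp.single j 1) = -2 * cos (π / M i j) := by
  simp [coroot]

theorem coroot_single_self (i : B) : coroot M i (Finsupp.single i 1) = 2 := by
  simp [coroot_single]

theorem isLiftable_reflection :
    M.IsLiftable fun i => reflection (coroot_single_self (M := M) i) := by
  intro i j
  obtain rfl | hij := eq_or_ne i j
  · simp only [M.diagonal, pow_one]
    ext1 z
    rw [LinearEquiv.mul_apply]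
    exact involutive_reflection _ z
  have hm1 := M.off_diagonal i j hij
  have hsymm := M.symmetric i j
  have hx := coroot_single (M := M) i j
  have hy := coroot_single (M := M) j i
  rw [← hsymm] at hy
  generalize M i j = m at *
  obtain rfl | hm0 := eq_or_ne m 0
  · simp
  obtain rfl | hm2 := eq_or_ne m 2
  · simp at hx hy
    ext1 z
    simp only [pow_two, LinearEquiv.mul_apply, reflection_apply, LinearEquiv.coe_one, id, map_sub,
      map_smul, hx, hy, coroot_single_self]
    module
  set θ : ℝ := 2 * (π / m) with hθ
  have hm3 : (3 : ℝ) ≤ m := by exact_mod_cast (by omega : 3 ≤ m)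
  have hmpos : (0 : ℝ) < m := by linarith
  have hmθ : m * θ = 2 * π := by rw [hθ]; field_simp
  have hsin : sin θ ≠ 0 := by
    apply (sin_pos_of_pos_of_lt_pi (by positivity) _).ne'
    nlinarith [pi_pos, show 0 < θ by positivity]
  have ht : 2 * cos θ = coroot M i (Finsupp.single j 1) * coroot M j (Finsupp.single i 1) - 2 := by
    rw [hx, hy, hθ, cos_two_mul]; ring
  have hS (k : ℤ) := Polynomial.Chebyshev.S_two_mul_real_cos θ k
  ext1 z
  rw [reflection_mul_reflection_pow_apply _ _ m z (2 * cos θ) ht]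
  obtain ⟨p, hp⟩ | ⟨p, hp⟩ := Nat.even_or_odd m
  · have h0 : (Polynomial.Chebyshev.S ℝ (p - 1)).eval (2 * cos θ) = 0 := by
      apply (mul_eq_zero.1 ((hS _).trans _)).resolve_right hsin
      have : ((p - 1 : ℤ) + 1 : ℝ) * θ = π := by
        have : (m : ℝ) = p + p := by exact_mod_cast hp
        push_cast
        rw [this] at hmθ; linarith
      push_cast at this ⊢
      rw [this, sin_pi]
    rw [show ((m : ℤ) - 2) / 2 = p - 1 by omega, show ((m : ℤ) - 1) / 2 = p - 1 by omega, h0]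
    simp
  · have h0 : (Polynomial.Chebyshev.S ℝ p).eval (2 * cos θ) +
        (Polynomial.Chebyshev.S ℝ (p - 1)).eval (2 * cos θ) = 0 := by
      apply (mul_eq_zero.1 _).resolve_right hsin
      rw [add_mul, hS, hS]
      have h1 : ((p : ℤ) + 1 : ℝ) * θ = 2 * π - p * θ := by
        have : (m : ℝ) = 2 * p + 1 := by exact_mod_cast hp
        push_cast
        rw [this] at hmθ; linarith
      push_cast at h1 ⊢
      rw [h1, sin_two_pi_sub]
      simp
    rw [show ((m : ℤ) - 2) / 2 = p - 1 by omega, show ((m : ℤ) - 1) / 2 = p by omega,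
      show ((m : ℤ) - 3) / 2 = p - 1 by omega, show (m : ℤ) / 2 = p by omega, h0]
    simp

theorem simple_injective : Function.Injective cs.simple := by
  intro i j h
  by_contra hij
  have key (k : B) := cs.lift_apply_simple (isLiftable_reflection (M := M)) k
  have h' := (key i).symm.trans ((congrArg _ h).trans (key j))
  have := congrArg (fun r => r (Finsupp.single i 1) i) h'
  simp [reflection_apply, hij] at this
  norm_num at this

end Geometric

end CoxeterSystem

section Bruhat

variable {B : Type*} {W : Type*} [Group W] {M : CoxeterMatrix B} {cs : CoxeterSystem M W}

theorem bruhatLE.of_isReflection {u t : W} (ht : cs.IsReflection t)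
    (h : cs.length u < cs.length (u * t)) : bruhatLE cs u (u * t) :=
  .single ⟨t, ht, rfl, h⟩

theorem bruhatLE.trans {u v w : W} (h : bruhatLE cs u v) (h' : bruhatLE cs v w) :
    bruhatLE cs u w :=
  Relation.ReflTransGen.trans h h'

theorem bruhatLE.eq_or_length_lt {u v : W} (h : bruhatLE cs u v) :
    u = v ∨ cs.length u < cs.length v := by
  induction h with
  | refl => exact .inl rfl
  | tail _ h' ih =>
    obtain ⟨t, -, -, hlt⟩ := h'
    obtain rfl | h := ih
    · exact .inr hlt
    · exact .inr (h.trans hlt)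

theorem bruhatLE_mul_simple {u : W} {i : B} (h : ¬ cs.IsRightDescent u i) :
    bruhatLE cs u (u * cs.simple i) :=
  .of_isReflection (cs.isReflection_simple i) (by rw [cs.not_isRightDescent_iff] at h; omega)

theorem mul_simple_bruhatLE {u : W} {i : B} (h : cs.IsRightDescent u i) :
    bruhatLE cs (u * cs.simple i) u := by
  simpa using bruhatLE_mul_simple (cs.isRightDescent_iff_not_isRightDescent_mul.1 h)

/-- A length-increasing reflection step which increases the length by one is a cover. -/
theorem bCov_of_length_add_one {u v : W} (h : bruhatLE cs u v)
    (hl : cs.length u + 1 = cs.length v) : bCov cs u v := by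
  refine ⟨h, by rintro rfl; omega, fun z h1 h2 => ?_⟩
  obtain rfl | h1 := h1.eq_or_length_lt
  · exact .inl rfl
  obtain rfl | h2 := h2.eq_or_length_lt
  · exact .inr rfl
  omega

/-- Multiplying both sides of a length-increasing reflection step by a simple reflection either
gives such a step, or swaps the two elements. -/
theorem length_mul_simple_lt_or_eq {x t : W} (ht : cs.IsReflection t)
    (h : cs.length x < cs.length (x * t)) (i : B) :
    cs.length (x * cs.simple i) < cs.length (x * t * cs.simple i) ∨
      x * cs.simple i = x * t := by
  have ht' : cs.IsReflection (cs.simple i * t * cs.simple i) := by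
    simpa using ht.conj (cs.simple i)
  have hne := ht'.length_mul_left_ne (x * cs.simple i)
  rw [show x * cs.simple i * (cs.simple i * t * cs.simple i) = x * t * cs.simple i by
    simp [mul_assoc]] at hne
  by_contra! hcon
  obtain ⟨h1, h2⟩ := hcon
  have hx := cs.length_mul_simple x i
  have hy := cs.length_mul_simple (x * t) i
  have hlx : cs.length (x * cs.simple i) = cs.length x + 1 := by omega
  have hly : cs.length (x * t * cs.simple i) + 1 = cs.length (x * t) := by omega
  have hlxy : cs.length (x * t) = cs.length x + 1 := by omega
  obtain ⟨ω, hω, he⟩ := cs.exists_isReduced (x * t * cs.simple i)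
  have hprod : cs.wordProd (ω ++ [i]) = x * t := by simp [wordProd_append, ← he]
  have hinv : cs.IsRightInversion (cs.wordProd (ω ++ [i])) t := by
    rw [hprod]; refine ⟨ht, ?_⟩
    rwa [mul_assoc, ht.mul_self, mul_one]
  obtain ⟨j, hj, hxe⟩ := cs.exists_wordProd_eraseIdx_of_isRightInversion hinv
  rw [hprod, mul_assoc x, ht.mul_self, mul_one] at hxe
  rw [List.length_append, List.length_singleton] at hj
  obtain hj' | rfl : j < ω.length ∨ j = ω.length := by omega
  · rw [List.eraseIdx_append_of_lt_length hj', wordProd_append, wordProd_singleton] at hxe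
    have hle := cs.length_wordProd_le (ω.eraseIdx j)
    rw [hxe, simple_mul_simple_cancel_right, ← hxe] at hlx
    have h3 := List.length_eraseIdx_add_one hj'
    have h4 : cs.length (x * t * cs.simple i) = ω.length := by rw [he]; exact hω
    omega
  · apply h2
    rw [List.eraseIdx_append_of_length_le le_rfl] at hxe
    simp only [Nat.sub_self, List.eraseIdx_cons_zero, List.append_nil] at hxe
    have h4 : x = x * t * cs.simple i := hxe.trans he.symm
    nth_rw 1 [h4]
    rw [simple_mul_simple_cancel_right]

theorem bruhatLE_mul_simple_of_length_lt {x t : W} (ht : cs.IsReflection t) (i : B)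
    (h : cs.length (x * cs.simple i) < cs.length (x * t * cs.simple i)) :
    bruhatLE cs (x * cs.simple i) (x * t * cs.simple i) := by
  have ht' : cs.IsReflection (cs.simple i * t * cs.simple i) := by
    simpa using ht.conj (cs.simple i)
  have he : x * cs.simple i * (cs.simple i * t * cs.simple i) = x * t * cs.simple i := by
    simp [mul_assoc]
  rw [← he] at h ⊢
  exact .of_isReflection ht' h

/-- The lifting property. -/
theorem bruhatLE.mul_simple_left {x y : W} (h : bruhatLE cs x y) (i : B) :
    bruhatLE cs (x * cs.simple i) y ∨ bruhatLE cs (x * cs.simple i) (y * cs.simple i) := by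
  induction h with
  | refl => exact .inr .refl
  | @tail y z _ h' ih =>
    obtain ⟨t, ht, rfl, hlt⟩ := h'
    have hyz := bruhatLE.of_isReflection ht hlt
    obtain h | h := ih
    · exact .inl (h.trans hyz)
    · obtain h3 | h3 := length_mul_simple_lt_or_eq ht hlt i
      · exact .inr (h.trans (bruhatLE_mul_simple_of_length_lt ht i h3))
      · exact .inl (h3 ▸ h)

/-- Below the end of a length-increasing reflection step there is an element of length one less. -/
theorem exists_between_of_isReflection {u t : W} (ht : cs.IsReflection t)
    (h : cs.length u < cs.length (u * t)) :
    ∃ z, bruhatLE cs u z ∧ bruhatLE cs z (u * t) ∧ cs.length z + 1 = cs.length (u * t) := by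
  induction hn : cs.length (u * t) generalizing u t with
  | zero => omega
  | succ n ih =>
    have hne : u * t ≠ 1 := by rintro h; simp [h] at hn
    obtain ⟨i, hi⟩ := cs.exists_rightDescent_of_ne_one hne
    have hvs := mul_simple_bruhatLE hi
    have hi' := cs.isRightDescent_iff.1 hi
    obtain h1 | h1 := length_mul_simple_lt_or_eq ht h i
    swap
    · refine ⟨u, .refl, .of_isReflection ht h, ?_⟩
      rw [← h1, simple_mul_simple_cancel_right] at hi'
      rw [h1] at hi'
      omega
    have huv := bruhatLE_mul_simple_of_length_lt ht i h1
    by_cases hu : cs.IsRightDescent u i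
    swap
    · exact ⟨u * t * cs.simple i, (bruhatLE_mul_simple hu).trans huv, hvs, by omega⟩
    have he : u * cs.simple i * (cs.simple i * t * cs.simple i) = u * t * cs.simple i := by
      simp [mul_assoc]
    have ht' : cs.IsReflection (cs.simple i * t * cs.simple i) := by
      simpa using ht.conj (cs.simple i)
    obtain ⟨z, hz1, hz2, hz3⟩ := ih ht' (by rwa [he]) (by rw [he]; omega)
    rw [he] at hz2
    have hl := hz1.mul_simple_left i
    rw [simple_mul_simple_cancel_right] at hl
    have key (hz : bruhatLE cs u z) : ∃ z, bruhatLE cs u z ∧ bruhatLE cs z (u * t) ∧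
        cs.length z + 1 = n + 1 := ⟨u * t * cs.simple i, hz.trans hz2, hvs, by omega⟩
    obtain hl | hl := hl
    · exact key hl
    by_cases hz : cs.IsRightDescent z i
    · exact key (hl.trans (mul_simple_bruhatLE hz))
    rw [cs.not_isRightDescent_iff] at hz
    have hlz := hz2.mul_simple_left i
    rw [simple_mul_simple_cancel_right] at hlz
    refine ⟨z * cs.simple i, hl, ?_, by omega⟩
    exact hlz.elim (fun h => h.trans hvs) id

/-- In the Bruhat order, covers are given by reflections increasing the length by one. -/
theorem bCov.exists_isReflection {u v : W} (h : bCov cs u v) :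
    ∃ t, cs.IsReflection t ∧ v = u * t ∧ cs.length u + 1 = cs.length v := by
  obtain ⟨hle, hne, hmin⟩ := h
  obtain heq | ⟨w, hw, t, ht, rfl, hlt⟩ := Relation.ReflTransGen.cases_tail hle
  · exact absurd heq.symm hne
  obtain rfl | heq := hmin w hw (.of_isReflection ht hlt)
  · obtain ⟨z, hz1, hz2, hz3⟩ := exists_between_of_isReflection ht hlt
    obtain rfl | rfl := hmin z hz1 hz2
    · exact ⟨t, ht, rfl, hz3⟩
    · omega
  · rw [← heq] at hlt
    exact absurd hlt (lt_irrefl _)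

theorem bruhatLE.exists_sublist {x : W} {ω : List B} (h : bruhatLE cs x (cs.wordProd ω)) :
    ∃ ω', ω'.Sublist ω ∧ cs.wordProd ω' = x := by
  induction h using Relation.ReflTransGen.head_induction_on with
  | refl => exact ⟨ω, .refl _, rfl⟩
  | @head x y h' _ ih =>
    obtain ⟨t, ht, rfl, hlt⟩ := h'
    obtain ⟨ω', hs, hp⟩ := ih
    have hinv : cs.IsRightInversion (cs.wordProd ω') t := by
      rw [hp]; refine ⟨ht, ?_⟩
      rwa [mul_assoc, ht.mul_self, mul_one]
    obtain ⟨j, -, he⟩ := cs.exists_wordProd_eraseIdx_of_isRightInversion hinv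
    rw [hp, mul_assoc, ht.mul_self, mul_one] at he
    exact ⟨ω'.eraseIdx j, (List.eraseIdx_sublist _ _).trans hs, he.symm⟩

theorem mem_of_simple_bruhatLE {a : B} {ω : List B}
    (h : bruhatLE cs (cs.simple a) (cs.wordProd ω)) : a ∈ ω := by
  obtain ⟨ω₁, hs₁, hp₁⟩ := h.exists_sublist
  obtain ⟨ω₂, hs₂, hr, hp₂⟩ := cs.exists_isReduced_sublist ω₁
  have hlen := hr.eq
  rw [hp₂, hp₁, length_simple] at hlen
  obtain ⟨b, rfl⟩ := List.length_eq_one_iff.1 hlen.symm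
  rw [hp₁, wordProd_singleton] at hp₂
  rw [cs.simple_injective hp₂] at hs₂
  exact (hs₂.trans hs₁).subset (by simp)

theorem wordProd_dropLast_bruhatLE {ω : List B} {i : B} (h : cs.IsReduced (ω ++ [i])) :
    bruhatLE cs (cs.wordProd ω) (cs.wordProd (ω ++ [i])) := by
  have h1 := h.eq
  rw [wordProd_append, wordProd_singleton, List.length_append, List.length_singleton] at h1
  rw [wordProd_append, wordProd_singleton]
  apply bruhatLE.of_isReflection (cs.isReflection_simple i)
  have := cs.length_wordProd_le ω
  omega

theorem simple_bruhatLE_of_mem {a : B} {ω : List B} (hω : cs.IsReduced ω) (h : a ∈ ω) :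
    bruhatLE cs (cs.simple a) (cs.wordProd ω) := by
  have one_le (w : W) : bruhatLE cs 1 w := by
    obtain ⟨ω, hω, rfl⟩ := cs.exists_isReduced w
    induction ω using List.reverseRecOn with
    | nil => exact cs.wordProd_nil ▸ .refl
    | append_singleton ω i ih =>
      exact (ih (by simpa using hω.take ω.length)).trans (wordProd_dropLast_bruhatLE hω)
  induction ω using List.reverseRecOn with
  | nil => simp at h
  | append_singleton ω i ih =>
    have hr : cs.IsReduced ω := by simpa using hω.take ω.length
    have hle := wordProd_dropLast_bruhatLE hω
    obtain h | h := List.mem_append.1 h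
    · exact (ih hr h).trans hle
    obtain rfl := List.mem_singleton.1 h
    have hl := (one_le (cs.wordProd ω)).mul_simple_left a
    rw [one_mul] at hl
    obtain hl | hl := hl
    · exact hl.trans hle
    · simpa [wordProd_append] using hl

/-- An element of length at least two has two distinct coatoms. -/
theorem exists_bCov_ne {w : W} (hw : 2 ≤ cs.length w) (u : W) : ∃ c, bCov cs c w ∧ c ≠ u := by
  obtain ⟨ω, hω, rfl⟩ := cs.exists_isReduced w
  rw [hω.eq] at hw
  obtain ⟨i, ω, rfl⟩ := List.exists_cons_of_length_pos (by omega : 0 < ω.length)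
  obtain ⟨ω, j, rfl⟩ := (List.eq_nil_or_concat' ω).resolve_left (by rintro rfl; simp at hw)
  have hl : cs.IsReduced (i :: ω) := by simpa using hω.take (ω.length + 1)
  have hr : cs.IsReduced (ω ++ [j]) := by simpa using hω.drop 1
  have c1 : bCov cs (cs.wordProd (i :: ω)) (cs.wordProd (i :: (ω ++ [j]))) := by
    apply bCov_of_length_add_one
    · exact wordProd_dropLast_bruhatLE (ω := i :: ω) hω
    · rw [hω.eq, hl.eq]; simp
  have c2 : bCov cs (cs.wordProd (ω ++ [j])) (cs.wordProd (i :: (ω ++ [j]))) := by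
    have hlen : cs.length (cs.wordProd (ω ++ [j])) + 1 =
        cs.length (cs.wordProd (i :: (ω ++ [j]))) := by
      rw [hω.eq, hr.eq]; simp
    apply bCov_of_length_add_one _ hlen
    have he : cs.wordProd (i :: (ω ++ [j])) = cs.wordProd (ω ++ [j]) *
        ((cs.wordProd (ω ++ [j]))⁻¹ * cs.simple i * (cs.wordProd (ω ++ [j]))⁻¹⁻¹) := by
      rw [wordProd_cons]; group
    rw [he] at hlen ⊢
    exact .of_isReflection ((cs.isReflection_simple i).conj _) (by omega)
  have hne : cs.wordProd (i :: ω) ≠ cs.wordProd (ω ++ [j]) := by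
    intro heq
    have hnd := hω.nodup_rightInvSeq
    rw [← List.cons_append, ← List.concat_eq_append, rightInvSeq_concat,
      List.concat_eq_append] at hnd
    refine (List.nodup_append.1 hnd).2.2 (cs.simple j) ?_ (cs.simple j) (by simp) rfl
    rw [rightInvSeq, List.map_cons]
    apply List.mem_cons.2 (.inl _)
    rw [wordProd_cons, wordProd_append, wordProd_singleton] at heq
    have h2 : (cs.wordProd ω)⁻¹ * cs.simple i * cs.wordProd ω = cs.simple j := by
      rw [mul_assoc, heq]; group
    rw [h2]; simp
  by_cases h : cs.wordProd (i :: ω) = u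
  · exact ⟨_, c2, h ▸ hne.symm⟩
  · exact ⟨_, c1, h⟩

/-- If a partial special matching maps `x` to a larger element `φ x`, then `φ 1 ≤ φ x`. -/
theorem BSM.map_one_bruhatLE (φ : BSM cs) {x : W} (hx : x ∈ φ.dom) (h : bCov cs x (φ.toFun x)) :
    bruhatLE cs (φ.toFun 1) (φ.toFun x) := by
  induction hn : cs.length x using Nat.strong_induction_on generalizing x with
  | _ n ih =>
    obtain rfl | hx1 := eq_or_ne x 1
    · exact .refl
    have hlen : 2 ≤ cs.length (φ.toFun x) := by
      obtain ⟨t, -, -, hl⟩ := h.exists_isReflection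
      have : cs.length x ≠ 0 := fun h0 => hx1 (cs.length_eq_zero_iff.1 h0)
      omega
    obtain ⟨c, hc, hcx⟩ := exists_bCov_ne hlen x
    have hmem : c ∈ bCoat cs (φ.toFun x) := hc
    rw [φ.coatom x hx h] at hmem
    obtain hmem | ⟨v, hvx, hv, rfl⟩ := hmem
    · exact absurd hmem hcx
    obtain ⟨t, -, -, hl⟩ := hvx.exists_isReflection
    exact (ih _ (by omega) (φ.ideal hx hvx.1) hv rfl).trans hc.1

end Bruhat
/-- if `q ∈ dom(φ)` and `a = φ(e)` is not in the support of `q` (i.e.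
`a ≰ q` in Bruhat order), then `q ⋖ φ(q)`, and any reduced word for `φ(q)` contains the
letter `a` exactly once; deleting it yields a reduced word for `q`. -/
theorem stmt15 {B : Type*} {W : Type*} [Group W] [DecidableEq B] {M : CoxeterMatrix B}
    (cs : CoxeterSystem M W) (φ : BSM cs) (hmax : BMax φ)
    (h1 : (1 : W) ∈ φ.dom) (a : B) (ha : φ.toFun 1 = cs.simple a)
    (q : W) (hq : q ∈ φ.dom) (hsupp : ¬ bruhatLE cs (cs.simple a) q) :
    bCov cs q (φ.toFun q) ∧
      ∀ μ : List B, cs.IsReduced μ → cs.wordProd μ = φ.toFun q →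
        μ.count a = 1 ∧ cs.IsReduced (μ.erase a) ∧ cs.wordProd (μ.erase a) = q := by
  have hcov : bCov cs q (φ.toFun q) := by
    refine (φ.cov q hq).resolve_left fun h => hsupp ?_
    have := φ.map_one_bruhatLE (φ.maps q hq) (by rwa [φ.invol q hq])
    rwa [φ.invol q hq, ha] at this
  refine ⟨hcov, fun μ hμ hprod => ?_⟩
  have ha_mem : a ∈ μ := by
    apply mem_of_simple_bruhatLE (cs := cs)
    rw [hprod, ← ha]
    exact φ.map_one_bruhatLE hq hcov
  obtain ⟨t, ht, hqt, hlen⟩ := hcov.exists_isReflection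
  have hinv : cs.IsRightInversion (cs.wordProd μ) t := by
    refine ⟨ht, ?_⟩
    rw [hprod, ← hlen, hqt, mul_assoc, ht.mul_self, mul_one]
    exact Nat.lt_succ_self _
  obtain ⟨j, hj, he⟩ := cs.exists_wordProd_eraseIdx_of_isRightInversion hinv
  rw [hprod, hqt, mul_assoc, ht.mul_self, mul_one] at he
  have hred : cs.IsReduced (μ.eraseIdx j) := by
    have h2 := List.length_eraseIdx_add_one hj
    have h3 := hμ.eq
    rw [hprod, ← hlen] at h3
    rw [CoxeterSystem.IsReduced, ← he]
    omega
  have hnot : a ∉ μ.eraseIdx j := fun h => hsupp (he ▸ simple_bruhatLE_of_mem hred h)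
  have hperm := List.getElem_cons_eraseIdx_perm hj
  have hja : μ[j] = a := by
    by_contra hne
    have := hperm.mem_iff.2 ha_mem
    simp [Ne.symm hne, hnot] at this
  have hsplit : μ = μ.take j ++ a :: μ.drop (j + 1) := by
    rw [← hja, ← List.drop_eq_getElem_cons hj, List.take_append_drop]
  have herase : μ.erase a = μ.eraseIdx j := by
    rw [List.eraseIdx_eq_take_drop_succ] at hnot ⊢
    rw [List.mem_append, not_or] at hnot
    conv_lhs => rw [hsplit]
    rw [List.erase_append_right _ hnot.1, List.erase_cons_head]
  refine ⟨?_, herase ▸ hred, herase ▸ he.symm⟩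
  rw [← hperm.count_eq, hja, List.count_cons_self, List.count_eq_zero_of_not_mem hnot]
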